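/- Let N ≥ 1 be a natural number, let Ω be a nonempty bounded open subset of the Euclidean space ℝ^N, let U be an open set containing the closure of Ω, and let λ be a nonzero real number. Then the following are equivalent: (i) there exists u : ℝ^N → ℝ, smooth on U and not identically zero on Ω, with Δ(Δu) = λ·u on Ω, and with Δu = 0 and the Fréchet derivative of Δu equal to 0 at every point of the frontier of Ω; (ii) there exists w : ℝ^N → ℝ, smooth on U and not identically zero on Ω, with Δ(Δw) = λ·w on Ω, and with w = 0 and the Fréchet derivative of w equal to 0 at every point of the frontier of Ω. -/

import Mathlib

/-- The Laplacian of `f : ℝ^N → ℝ`: the trace of the second derivative,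
`Δf(x) = Σ_i ∂²f/∂x_i²(x)`. -/
noncomputable def lap {N : ℕ} (f : EuclideanSpace ℝ (Fin N) → ℝ)
    (x : EuclideanSpace ℝ (Fin N)) : ℝ :=
  ∑ i : Fin N, iteratedFDeriv ℝ 2 f x
    ![EuclideanSpace.single i (1 : ℝ), EuclideanSpace.single i (1 : ℝ)]

open Set Filter Topology

section Laplacian

variable {N : ℕ} {f g : EuclideanSpace ℝ (Fin N) → ℝ} {s : Set (EuclideanSpace ℝ (Fin N))}
  {x : EuclideanSpace ℝ (Fin N)}

theorem Filter.EventuallyEq.lap_eq (h : f =ᶠ[𝓝 x] g) : lap f x = lap g x := by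
  simp only [lap, (h.iteratedFDeriv ℝ 2).eq_of_nhds]

theorem Set.EqOn.lap (h : EqOn f g s) (hs : IsOpen s) : EqOn (lap f) (lap g) s :=
  fun _ hx => (h.eventuallyEq_of_mem (hs.mem_nhds hx)).lap_eq

theorem lap_zero (x : EuclideanSpace ℝ (Fin N)) :
    lap (fun _ : EuclideanSpace ℝ (Fin N) => (0 : ℝ)) x = 0 := by
  simp [lap, iteratedFDeriv_const_of_ne two_ne_zero]

theorem lap_const_mul (c : ℝ) (hf : ContDiffAt ℝ 2 f x) :
    lap (fun y => c * f y) x = c * lap f x := by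
  have h := iteratedFDeriv_const_smul_apply (i := 2) (a := c) hf
  change iteratedFDeriv ℝ 2 (fun y => c * f y) x = _ at h
  simp [lap, h, Finset.mul_sum]

theorem ContDiffOn.lap (hf : ContDiffOn ℝ (⊤ : ℕ∞) f s) (hs : IsOpen s) :
    ContDiffOn ℝ (⊤ : ℕ∞) (lap f) s := by
  have h : ContDiffOn ℝ (⊤ : ℕ∞) (fderiv ℝ (fderiv ℝ f)) s :=
    (hf.fderiv_of_isOpen (m := (⊤ : ℕ∞)) hs (by simp)).fderiv_of_isOpen hs (by simp)
  unfold _root_.lap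
  simp only [iteratedFDeriv_two_apply]
  exact ContDiffOn.sum fun i _ => (h.clm_apply contDiffOn_const).clm_apply contDiffOn_const

end Laplacian

/-- Two functions that are `C^1` around the closure of an open set and agree on that set have the
same values and first derivatives on its closure. -/
theorem Set.EqOn.closure_fderiv {E F : Type*} [NormedAddCommGroup E] [NormedSpace ℝ E]
    [NormedAddCommGroup F] [NormedSpace ℝ F] {f g : E → F} {s t : Set E} (h : EqOn f g s)
    (hs : IsOpen s) (ht : IsOpen t) (hst : closure s ⊆ t)
    (hf : ContDiffOn ℝ 1 f t) (hg : ContDiffOn ℝ 1 g t) :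
    EqOn f g (closure s) ∧ EqOn (fderiv ℝ f) (fderiv ℝ g) (closure s) := by
  refine ⟨h.of_subset_closure (hf.continuousOn.mono hst) (hg.continuousOn.mono hst)
    subset_closure subset_rfl, EqOn.of_subset_closure (s := s) (fun x hx => ?_)
    ((hf.continuousOn_fderiv_of_isOpen ht le_rfl).mono hst)
    ((hg.continuousOn_fderiv_of_isOpen ht le_rfl).mono hst) subset_closure subset_rfl⟩
  exact (h.eventuallyEq_of_mem (hs.mem_nhds hx)).fderiv_eq

/-- Classical-solution analogue of Theorem 3.3: the nonzero eigenvalues of the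
`σ = 1` Neumann problem for the biharmonic operator coincide with the
eigenvalues of the Dirichlet problem. -/
theorem stmt_11 (N : ℕ) (hN : 1 ≤ N)
    (Ω U : Set (EuclideanSpace ℝ (Fin N)))
    (hΩne : Ω.Nonempty) (hΩopen : IsOpen Ω) (hΩbd : Bornology.IsBounded Ω)
    (hUopen : IsOpen U) (hUcl : closure Ω ⊆ U)
    (lam : ℝ) (hlam : lam ≠ 0) :
    (∃ u : EuclideanSpace ℝ (Fin N) → ℝ, ContDiffOn ℝ (⊤ : ℕ∞) u U ∧
        (¬ ∀ x ∈ Ω, u x = 0) ∧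
        (∀ x ∈ Ω, lap (lap u) x = lam * u x) ∧
        (∀ x ∈ frontier Ω, lap u x = 0 ∧ fderiv ℝ (lap u) x = 0)) ↔
    (∃ w : EuclideanSpace ℝ (Fin N) → ℝ, ContDiffOn ℝ (⊤ : ℕ∞) w U ∧
        (¬ ∀ x ∈ Ω, w x = 0) ∧
        (∀ x ∈ Ω, lap (lap w) x = lam * w x) ∧
        (∀ x ∈ frontier Ω, w x = 0 ∧ fderiv ℝ w x = 0)) := by
  have hΩU : Ω ⊆ U := subset_closure.trans hUcl
  have lap_const_mul_on {c : ℝ} {f : EuclideanSpace ℝ (Fin N) → ℝ}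
      (hf : ContDiffOn ℝ (⊤ : ℕ∞) f U) :
      ∀ x ∈ U, lap (fun y => c * f y) x = c * lap f x := fun x hx =>
    lap_const_mul c ((hf.contDiffAt (hUopen.mem_nhds hx)).of_le
      (WithTop.coe_le_coe.2 (le_top : (2 : ℕ∞) ≤ ⊤)))
  have lap_ne {f : EuclideanSpace ℝ (Fin N) → ℝ} (hne : ¬ ∀ x ∈ Ω, f x = 0)
      (heq : ∀ x ∈ Ω, lap (lap f) x = lam * f x) : ¬ ∀ x ∈ Ω, lap f x = 0 := fun h =>
    hne fun x hx => by
      have h0 : lap (lap f) x = 0 :=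
        (EqOn.lap (g := fun _ => (0 : ℝ)) h hΩopen hx).trans (lap_zero x)
      simpa [heq x hx, hlam] using h0
  constructor
  · rintro ⟨u, hu, hne, heq, hbd⟩
    refine ⟨lap u, hu.lap hUopen, lap_ne hne heq, fun x hx => ?_, hbd⟩
    rw [EqOn.lap (g := fun y => lam * u y) heq hΩopen hx, lap_const_mul_on hu x (hΩU hx)]
  · rintro ⟨w, hw, hne, heq, hbd⟩
    have hlw := hw.lap hUopen
    have hu : ContDiffOn ℝ (⊤ : ℕ∞) (fun y => lam⁻¹ * lap w y) U := contDiffOn_const.mul hlw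
    have hlap : EqOn (lap fun y => lam⁻¹ * lap w y) w Ω := fun x hx => by
      rw [lap_const_mul_on hlw x (hΩU hx), heq x hx, inv_mul_cancel_left₀ hlam]
    obtain ⟨hval, hder⟩ := hlap.closure_fderiv hΩopen hUopen hUcl
      ((hu.lap hUopen).of_le (mod_cast le_top)) (hw.of_le (mod_cast le_top))
    refine ⟨fun y => lam⁻¹ * lap w y, hu, fun h => lap_ne hne heq fun x hx => ?_,
      fun x hx => ?_, fun x hx => ?_⟩
    · simpa [hlam] using h x hx
    · rw [hlap.lap hΩopen hx, mul_inv_cancel_left₀ hlam]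
    · have hx' := frontier_subset_closure hx
      exact ⟨(hval hx').trans (hbd x hx).1, (hder hx').trans (hbd x hx).2⟩
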